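/- arXiv:1907.13040 — 2 statements merged into one kernel-verified Lean document; each statement's English description precedes it below -/
import Mathlib

section
/- (Injectivity claim of Lemma 4.3(2).) For all sufficiently large r (depending only on E/F and θ) the following holds. Let a ∈ F^× with v(a) = s ≥ r. If b, b' ∈ B_a satisfy b − b' ∈ ϖ^r(θ − θ^c)O_E and q(b')/q(b) ∈ q(1 + ϖ^{r+s}O_E), then b' ∈ b·G_a. Equivalently, the map sending b to the pair (b mod ϖ^r(θ − θ^c)O_E, class of q(b) modulo q(1 + ϖ^{r+s}O_E)) induces an injection from the orbit space B_a/G_a into (O_E/ϖ^r(θ − θ^c)O_E)^× × (1 − a(1 + ϖ^rO_F))/q(1 + ϖ^{r+s}O_E). -/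
/-- The ring of integers of a `p`-adic field: the integral closure of `ℤ_[p]`. -/
noncomputable def ringOfIntegers (p : ℕ) [Fact p.Prime] (K : Type*) [Field K]
    [Algebra ℚ_[p] K] : Subring K :=
  letI : Algebra ℤ_[p] K :=
    ((algebraMap ℚ_[p] K).comp (PadicInt.Coe.ringHom)).toAlgebra
  (integralClosure ℤ_[p] K).toSubring

/-- The subset `1 + ϖ^n O_E` of `E`. -/
def onePlusSet (p : ℕ) [Fact p.Prime] (F E : Type*) [Field F] [Field E]
    [Algebra ℚ_[p] F] [Algebra ℚ_[p] E] [Algebra F E]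
    (ϖ : ringOfIntegers p F) (n : ℕ) : Set E :=
  {t | ∃ y ∈ ringOfIntegers p E, t = 1 + algebraMap F E ((ϖ : F) ^ n) * y}

/-- The group `N₁(r) = {u ∈ 1 + ϖ^r(θ − θᶜ)O_E : N_{E/F}(u) = 1}`. -/
def N1Set (p : ℕ) [Fact p.Prime] (F E : Type*) [Field F] [Field E]
    [Algebra ℚ_[p] F] [Algebra ℚ_[p] E] [Algebra F E]
    (c : E → E) (ϖ : ringOfIntegers p F) (θ : E) (r : ℕ) : Set E :=
  {u | (∃ y ∈ ringOfIntegers p E,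
      u = 1 + algebraMap F E ((ϖ : F) ^ r) * (θ - c θ) * y) ∧ u * c u = 1}

/-- The set `B_a = {b ∈ O_E : q(b) ∈ 1 − a(1 + ϖ^r O_F)}`. -/
def BSet (p : ℕ) [Fact p.Prime] (F E : Type*) [Field F] [Field E]
    [Algebra ℚ_[p] F] [Algebra ℚ_[p] E] [Algebra F E]
    (c : E → E) (ϖ : ringOfIntegers p F) (r : ℕ) (a : F) : Set E :=
  {b | b ∈ ringOfIntegers p E ∧
    ∃ u ∈ ringOfIntegers p F, b * c b = algebraMap F E (1 - a * (1 + (ϖ : F) ^ r * u))}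

/-- The group `G_a = (1 + ϖ^{r+s} O_E)·N₁(r)`. -/
def GSet (p : ℕ) [Fact p.Prime] (F E : Type*) [Field F] [Field E]
    [Algebra ℚ_[p] F] [Algebra ℚ_[p] E] [Algebra F E]
    (c : E → E) (ϖ : ringOfIntegers p F) (θ : E) (r s : ℕ) : Set E :=
  {g | ∃ g₁ ∈ onePlusSet p F E ϖ (r + s), ∃ g₂ ∈ N1Set p F E c ϖ θ r, g = g₁ * g₂}

open Polynomial in
theorem mem_ringOfIntegers_iff_spectralNorm_le_one (p : ℕ) [Fact p.Prime] {K : Type*} [Field K]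
    [Algebra ℚ_[p] K] [Algebra.IsAlgebraic ℚ_[p] K] (x : K) :
    x ∈ ringOfIntegers p K ↔ spectralNorm ℚ_[p] K x ≤ 1 := by
  let : Algebra ℤ_[p] K :=
    ((algebraMap ℚ_[p] K).comp (PadicInt.Coe.ringHom)).toAlgebra
  have : IsScalarTower ℤ_[p] ℚ_[p] K := IsScalarTower.of_algebraMap_eq fun _ => rfl
  have hx : IsIntegral ℚ_[p] x := (Algebra.IsAlgebraic.isAlgebraic x).isIntegral
  change IsIntegral ℤ_[p] x ↔ _
  rw [spectralNorm, spectralValue_le_one_iff (minpoly.monic hx)]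
  constructor
  · intro h n
    rw [minpoly.isIntegrallyClosed_eq_field_fractions' ℚ_[p] h, coeff_map]
    exact ((minpoly ℤ_[p] x).coeff n).2
  · intro h
    have hl : minpoly ℚ_[p] x ∈ lifts (algebraMap ℤ_[p] ℚ_[p]) :=
      (lifts_iff_coeff_lifts _).2 fun n => ⟨⟨_, h n⟩, rfl⟩
    obtain ⟨q, hq, -, hm⟩ := lifts_and_degree_eq_and_monic hl (minpoly.monic hx)
    refine ⟨q, hm, ?_⟩
    rw [← aeval_def, ← aeval_map_algebraMap ℚ_[p], hq, minpoly.aeval]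

/-- **Injectivity claim of Lemma 4.3(2).**
Let `F` be a finite extension of `ℚ_p` with ring of integers `O_F` and uniformizer `ϖ`, let
`E/F` be a quadratic extension with ring of integers `O_E = O_F + θ·O_F`, and let `c` be the
nontrivial `F`-automorphism of `E`, `q = N_{E/F}`.  For all sufficiently large `r` the
following holds: for `a ∈ F^×` with `v(a) = s ≥ r`, if `b, b' ∈ B_a` satisfy
`b − b' ∈ ϖ^r(θ − θᶜ)O_E` and `q(b')/q(b) ∈ q(1 + ϖ^{r+s}O_E)`, then `b' ∈ b·G_a`. -/
theorem injectivity_of_orbit_invariants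
    (p : ℕ) [Fact p.Prime]
    (F : Type*) [Field F] [Algebra ℚ_[p] F] [FiniteDimensional ℚ_[p] F]
    (E : Type*) [Field E] [Algebra ℚ_[p] E] [Algebra F E] [IsScalarTower ℚ_[p] F E]
    (hquad : Module.finrank F E = 2)
    (c : E ≃ₐ[F] E)
    (ϖ : ringOfIntegers p F) (hϖ : Irreducible ϖ)
    (θ : E) (hθmem : θ ∈ ringOfIntegers p E)
    (hgen : ∀ x : E, x ∈ ringOfIntegers p E ↔
      ∃ a b : ringOfIntegers p F, x = algebraMap F E (a : F) + θ * algebraMap F E (b : F))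
    (hθc : c θ ≠ θ) :
    ∃ r₀ : ℕ, 1 ≤ r₀ ∧ ∀ r : ℕ, r₀ ≤ r → ∀ s : ℕ, r ≤ s → ∀ a : F,
      (∃ w : (ringOfIntegers p F)ˣ, a = (ϖ : F) ^ s * ((w : ringOfIntegers p F) : F)) →
      ∀ b ∈ BSet p F E (⇑c) ϖ r a, ∀ b' ∈ BSet p F E (⇑c) ϖ r a,
        (∃ y ∈ ringOfIntegers p E,
          b - b' = algebraMap F E ((ϖ : F) ^ r) * (θ - c θ) * y) →
        (∃ t ∈ onePlusSet p F E ϖ (r + s), b' * c b' = (b * c b) * (t * c t)) →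
        ∃ g ∈ GSet p F E (⇑c) ϖ θ r s, b' = b * g := by
  have : FiniteDimensional F E := Module.finite_of_finrank_pos (by omega)
  have : FiniteDimensional ℚ_[p] E := FiniteDimensional.trans ℚ_[p] F E
  have hO (x : E) := mem_ringOfIntegers_iff_spectralNorm_le_one p x
  simp only [← spectralMulAlgNorm_def] at hO
  have hOF (x : F) : x ∈ ringOfIntegers p F ↔
      spectralMulAlgNorm ℚ_[p] E (algebraMap F E x) ≤ 1 := by
    rw [mem_ringOfIntegers_iff_spectralNorm_le_one p x, spectralMulAlgNorm_def,
      spectralNorm.eq_of_tower (L := E)]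
  have hna (x y : E) : spectralMulAlgNorm ℚ_[p] E (x + y) ≤
      max (spectralMulAlgNorm ℚ_[p] E x) (spectralMulAlgNorm ℚ_[p] E y) :=
    isNonarchimedean_spectralNorm (K := ℚ_[p]) x y
  have hc (x : E) : spectralMulAlgNorm ℚ_[p] E (c x) = spectralMulAlgNorm ℚ_[p] E x :=
    (spectralNorm_eq_of_equiv (c.restrictScalars ℚ_[p]) x).symm
  generalize spectralMulAlgNorm ℚ_[p] E = f at hO hOF hna hc
  have hf1 : f 1 = 1 := map_one f
  have hone (x : E) (hx : f x < 1) : f (1 + x) = 1 := by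
    refine le_antisymm ((hna 1 x).trans (by rw [hf1]; exact max_le le_rfl hx.le)) ?_
    by_contra! h
    have := hna (1 + x) (-x)
    rw [add_neg_cancel_right, map_neg_eq_map, hf1] at this
    exact (max_lt h hx).not_ge this
  set π : E := algebraMap F E (ϖ : F) with hπ
  have hπ1 : f π < 1 := by
    refine lt_of_le_of_ne ((hOF _).1 ϖ.2) fun h => hϖ.not_isUnit ?_
    have h0 : (ϖ : F) ≠ 0 := fun h0 => hϖ.ne_zero (Subtype.ext h0)
    refine IsUnit.of_mul_eq_one ⟨(ϖ : F)⁻¹, (hOF _).2 ?_⟩ (Subtype.ext (mul_inv_cancel₀ h0))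
    rw [map_inv₀, map_inv₀, ← hπ, h, inv_one]
  have hπ0 : 0 ≤ f π := apply_nonneg f π
  have hδ : θ - c θ ≠ 0 := sub_ne_zero.2 hθc.symm
  have hfδ : 0 < f (θ - c θ) := map_pos_of_ne_zero f hδ
  obtain ⟨n, hn⟩ := exists_pow_lt_of_lt_one hfδ hπ1
  refine ⟨n + 1, by omega, ?_⟩
  rintro r hr s hs a ⟨w, rfl⟩ b ⟨hb, v, hv, hbv⟩ b' - ⟨y, hy, hby⟩ ⟨t, ⟨z, hz, rfl⟩, hbt⟩
  rw [hO] at hb hy hz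
  have hπlt (m : ℕ) (hm : n + 1 ≤ m) : f π ^ m < 1 := pow_lt_one₀ hπ0 hπ1 (by omega)
  have hfb : f b = 1 := by
    have hu := (hOF _).1 (Subring.add_mem _ (Subring.one_mem _)
      (Subring.mul_mem _ (Subring.pow_mem _ ϖ.2 r) hv))
    have hw := (hOF _).1 (w : ringOfIntegers p F).2
    have h := congrArg f hbv
    rw [map_sub, map_one, sub_eq_add_neg, hone, map_mul, hc] at h
    · nlinarith [apply_nonneg f b]
    · rw [map_neg_eq_map, map_mul, map_mul, map_mul, map_mul, map_pow, map_pow, ← hπ]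
      exact mul_lt_one_of_nonneg_of_lt_one_left (by positivity)
        (mul_lt_one_of_nonneg_of_lt_one_left (by positivity) (hπlt s (by omega)) hw) hu
  set t : E := 1 + algebraMap F E ((ϖ : F) ^ (r + s)) * z with ht
  have hft : f t = 1 := by
    apply hone
    rw [map_mul, map_pow, map_pow, ← hπ]
    exact mul_lt_one_of_nonneg_of_lt_one_left (by positivity) (hπlt _ (by omega)) hz
  have hb0 : b ≠ 0 := by rintro rfl; simp at hfb
  have ht0 : t ≠ 0 := by intro h; simp [h] at hft
  refine ⟨t * (b' / (b * t)), ⟨t, ⟨z, (hO z).2 hz, rfl⟩, b' / (b * t), ⟨⟨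
    -(y + b * (π ^ s / (θ - c θ)) * z) / (b * t), ?_, ?_⟩, ?_⟩, rfl⟩, by field_simp⟩
  · rw [hO, map_div₀, map_neg_eq_map, map_mul f b t, hfb, hft, mul_one, div_one]
    refine (hna _ _).trans (max_le hy ?_)
    rw [map_mul, map_mul, hfb, one_mul, map_div₀, map_pow]
    refine mul_le_one₀ ((div_le_one hfδ).2 ?_) (by positivity) hz
    exact (pow_le_pow_of_le_one hπ0 hπ1.le (by omega)).trans hn.le
  · have hb' : b' = b - algebraMap F E ((ϖ : F) ^ r) * (θ - c θ) * y := by rw [← hby]; ring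
    rw [hb', map_pow, ← hπ]
    field_simp
    rw [ht, map_pow, ← hπ]
    ring
  · have hcb0 : c b ≠ 0 := by simpa using hb0
    have hct0 : c t ≠ 0 := by simpa using ht0
    rw [map_div₀, map_mul, div_mul_div_comm, hbt]
    field_simp
end

section
/- (Uniform boundedness claim of Lemma 4.3(2).) For each sufficiently large r (depending only on E/F and θ) there exists a constant C, independent of a, such that for every a ∈ F^× with v(a) = s ≥ r, the number of orbits of the group G_a acting by multiplication on the set B_a is finite and at most C. -/
section FinitePadicAlgebra

variable {p : ℕ} [Fact p.Prime] {A : Type*} [CommRing A] [Algebra ℤ_[p] A]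

/-- In a free `ℤ_[p]`-algebra, divisibility by a power of `p` can be tested on coordinates. -/
lemma natCast_pow_dvd_iff_repr {ι : Type*} [Fintype ι] (b : Module.Basis ι ℤ_[p] A) (n : ℕ)
    (x : A) : (p : A) ^ n ∣ x ↔ ∀ i, (p : ℤ_[p]) ^ n ∣ b.repr x i := by
  have hp : ∀ y : A, (p : A) ^ n * y = (p : ℤ_[p]) ^ n • y := fun y => by
    simp [Algebra.smul_def]
  constructor
  · rintro ⟨y, rfl⟩ i
    exact ⟨b.repr y i, by simp [hp]⟩
  · intro h
    choose y hy using h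
    refine ⟨∑ i, y i • b i, ?_⟩
    rw [hp, Finset.smul_sum, ← b.sum_repr x]
    exact Finset.sum_congr rfl fun i _ => by rw [hy i, mul_smul]

lemma smodEq_span_natCast_pow_iff {R : Type*} [CommRing R] (q n : ℕ) (x y : R) :
    x ≡ y [SMOD (Ideal.span {(q : R)} ^ n • ⊤ : Submodule R R)] ↔ (q : R) ^ n ∣ x - y := by
  rw [SModEq.sub_mem, smul_eq_mul, Ideal.mul_top, Ideal.span_singleton_pow,
    Ideal.mem_span_singleton]

/-- A finite free `ℤ_[p]`-algebra is `p`-adically complete. -/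
lemma isAdicComplete_span_natCast [Module.Finite ℤ_[p] A] [Module.Free ℤ_[p] A] :
    IsAdicComplete (Ideal.span {(p : A)}) A := by
  have hZ : IsAdicComplete (Ideal.span {(p : ℤ_[p])}) ℤ_[p] := by
    rw [← PadicInt.maximalIdeal_eq_span_p]; infer_instance
  let b := Module.Free.chooseBasis ℤ_[p] A
  refine { haus' := fun x hx => ?_, prec' := fun f hf => ?_ }
  · refine b.ext_elem fun i => ?_
    rw [map_zero, Finsupp.zero_apply]
    refine hZ.haus' _ fun n => ?_
    have h := hx n
    rw [smodEq_span_natCast_pow_iff, sub_zero] at h ⊢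
    exact (natCast_pow_dvd_iff_repr b n x).1 h i
  · have key : ∀ i, ∃ L : ℤ_[p], ∀ n, (p : ℤ_[p]) ^ n ∣ b.repr (f n) i - L := by
      intro i
      obtain ⟨L, hL⟩ := hZ.prec' (fun n => b.repr (f n) i) fun {m n} hmn => by
        have h := hf hmn
        rw [smodEq_span_natCast_pow_iff] at h ⊢
        simpa using (natCast_pow_dvd_iff_repr b m _).1 h i
      exact ⟨L, fun n => (smodEq_span_natCast_pow_iff _ _ _ _).1 (hL n)⟩
    choose L hL using key
    refine ⟨∑ i, L i • b i, fun n => ?_⟩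
    rw [smodEq_span_natCast_pow_iff, natCast_pow_dvd_iff_repr b]
    intro i
    rw [map_sub, Finsupp.sub_apply, b.repr_sum_self]
    exact hL i n

lemma padicInt_hasFiniteQuotients : Ring.HasFiniteQuotients ℤ_[p] where
  finiteQuotient {I} hI := by
    obtain ⟨n, rfl⟩ := PadicInt.ideal_eq_span_pow_p hI
    rw [← PadicInt.ker_toZModPow]
    exact Finite.of_injective _ (RingHom.kerLift_injective (PadicInt.toZModPow (p := p) n))

/-- Every nonzero element of a domain that is integral over `ℤ_[p]` divides a power of `p`. -/
lemma exists_dvd_natCast_pow [IsDomain A] [FaithfulSMul ℤ_[p] A] {x : A} (hx : x ≠ 0)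
    (hint : IsIntegral ℤ_[p] x) : ∃ n : ℕ, x ∣ (p : A) ^ n := by
  obtain ⟨t, ht, hdvd⟩ := hint.isAlgebraic.exists_nonzero_dvd (mem_nonZeroDivisors_of_ne_zero hx)
  refine ⟨t.valuation, ?_⟩
  rw [PadicInt.unitCoeff_spec ht, map_mul, map_pow, map_natCast] at hdvd
  exact (((PadicInt.unitCoeff ht).isUnit.map (algebraMap ℤ_[p] A)).dvd_mul_left).1 hdvd

end FinitePadicAlgebra

section Henselian

open Polynomial

variable {R : Type*} [CommRing R] {I : Ideal R} [HenselianRing R I]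

lemma isUnit_one_add_of_mem_of_henselianRing {x : R} (hx : x ∈ I) : IsUnit (1 + x) := by
  have h := Ideal.mem_jacobson_bot.1 (HenselianRing.jac hx) 1
  rwa [mul_one, add_comm] at h

/-- Over a Henselian pair, `1 + 4y` with `y ∈ I` is the square of some `1 + 2z` with `y ∣ z`. -/
lemma exists_sq_eq_one_add_four_mul {y : R} (hy : y ∈ I) :
    ∃ z, y ∣ z ∧ (1 + 2 * z) ^ 2 = 1 + 4 * y := by
  have hmonic : (X ^ 2 + X - C y : R[X]).Monic := by
    nontriviality R
    monicity!
  obtain ⟨z, hz, hzI⟩ := HenselianRing.is_henselian (I := I) (X ^ 2 + X - C y) hmonic 0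
    (by simpa using hy) (by simp)
  have hz' : z * (1 + z) = y := by
    have : z ^ 2 + z - y = 0 := by simpa [IsRoot] using hz
    linear_combination this
  rw [sub_zero] at hzI
  refine ⟨z, ?_, by linear_combination 4 * hz'⟩
  rw [← hz', (isUnit_one_add_of_mem_of_henselianRing hzI).mul_right_dvd]

/-- In a domain, a Henselian pair has only trivial idempotents modulo `I`. -/
lemma mem_or_one_sub_mem_of_sq_sub_mem [IsDomain R] {e : R} (he : e ^ 2 - e ∈ I) :
    e ∈ I ∨ 1 - e ∈ I := by
  have hmonic : (X ^ 2 - X : R[X]).Monic := by monicity!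
  obtain ⟨a, ha, haI⟩ := HenselianRing.is_henselian (I := I) (X ^ 2 - X) hmonic e
    (by simpa using he) (by
      refine IsUnit.of_mul_eq_one (Ideal.Quotient.mk I (2 * e - 1)) ?_
      rw [← map_mul, ← map_one (Ideal.Quotient.mk I), Ideal.Quotient.eq]
      simp only [derivative_sub, derivative_X_pow, derivative_X, eval_sub, eval_mul, eval_one,
        eval_pow, eval_X, eval_C]
      have := I.mul_mem_left 4 he
      convert this using 1
      push_cast
      ring)
  have ha' : a * (a - 1) = 0 := by
    have : a ^ 2 - a = 0 := by simpa [IsRoot] using ha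
    linear_combination this
  rcases mul_eq_zero.1 ha' with h | h
  · left
    rw [h, zero_sub] at haI
    exact neg_mem_iff.1 haI
  · right
    rwa [sub_eq_zero.1 h] at haI

/-- A nonunit has a power in `I` if `R` is a domain, `(R, I)` is Henselian and `R ⧸ I` is finite. -/
lemma exists_pow_mem_of_not_isUnit [IsDomain R] [Finite (R ⧸ I)] {x : R} (hx : ¬IsUnit x) :
    ∃ n : ℕ, x ^ n ∈ I := by
  obtain ⟨m, n, hne, hmn⟩ := Finite.exists_ne_map_eq_of_infinite
    fun n : ℕ => Ideal.Quotient.mk I x ^ n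
  wlog hlt : m < n generalizing m n
  · exact this n m hne.symm hmn.symm (by omega)
  obtain ⟨d, rfl⟩ := Nat.exists_eq_add_of_lt hlt
  set y := Ideal.Quotient.mk I x
  have hmn' : y ^ m = y ^ m * y ^ (d + 1) := by rw [← pow_add]; exact hmn
  have hper : ∀ k, y ^ m = y ^ m * (y ^ (d + 1)) ^ k := by
    intro k
    induction k with
    | zero => simp
    | succ k ih => rw [pow_succ, ← mul_assoc, ← ih]; exact hmn'
  have hidem : (y ^ (d + 1)) ^ (m + 1) * (y ^ (d + 1)) ^ (m + 1) = (y ^ (d + 1)) ^ (m + 1) := by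
    have hle : m ≤ (d + 1) * (m + 1) := by nlinarith
    obtain ⟨t, ht⟩ := Nat.exists_eq_add_of_le hle
    have : (y ^ (d + 1)) ^ (m + 1) = y ^ t * y ^ m := by rw [← pow_mul, ht, pow_add, mul_comm]
    calc _ = y ^ t * (y ^ m * (y ^ (d + 1)) ^ (m + 1)) := by rw [← mul_assoc, ← this]
      _ = _ := by rw [← hper, this]
  rcases mem_or_one_sub_mem_of_sq_sub_mem (I := I) (e := (x ^ (d + 1)) ^ (m + 1)) (by
    rw [← Ideal.Quotient.eq, pow_two]
    simpa using hidem) with h | h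
  · exact ⟨_, by rwa [← pow_mul] at h⟩
  · refine absurd ?_ hx
    have := isUnit_one_add_of_mem_of_henselianRing (neg_mem h)
    rw [neg_sub, add_sub_cancel, ← pow_mul] at this
    exact (isUnit_pow_iff (by positivity)).1 this

end Henselian

section NormTorsor

variable {R S : Type*} [CommRing R] [CommRing S]

/-- If `b`, `b'` are congruent modulo a high power of `ϖ` and their norms are congruent modulo a
high power of `ϖ`, then `b'` is a multiple of `b` by the product of an element close to `1`
and an element of norm one. -/
lemma exists_eq_mul_mul_of_norm_congr {I : Ideal R} [HenselianRing R I]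
    (i : R →+* S) (c : S →+* S) (hci : ∀ x, c (i x) = i x)
    {ϖ : R} (hϖ : ϖ ∈ Ideal.jacobson (⊥ : Ideal R)) {k : ℕ} {y₀ : R} (hy₀ : y₀ ∈ I)
    (hk : ϖ ^ k = 4 * y₀) {δ ε : S} {m : ℕ} (hδ : i ϖ ^ m = δ * ε)
    {r s : ℕ} (hr : 1 ≤ r) (hmr : m ≤ r) (hrs : r ≤ s) {w u u' : R} {b b' : S}
    (hb : b * c b = i (1 - ϖ ^ s * w * (1 + ϖ ^ r * u)))
    (hb' : b' * c b' = i (1 - ϖ ^ s * w * (1 + ϖ ^ r * u')))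
    (hu : ϖ ^ k ∣ u - u') (hbb' : i ϖ ^ (2 * r) ∣ b' - b) :
    ∃ g₁ g₂ x y : S, g₁ = 1 + i ϖ ^ (r + s) * x ∧ g₂ = 1 + i ϖ ^ r * δ * y ∧
      g₂ * c g₂ = 1 ∧ b' = b * (g₁ * g₂) := by
  obtain ⟨t, ht⟩ := hu
  obtain ⟨d, hd⟩ := hbb'
  obtain ⟨s', rfl⟩ := Nat.exists_eq_add_of_le hrs
  obtain ⟨r', rfl⟩ := Nat.exists_eq_add_of_le hmr
  set r := m + r' with hr_def
  set N := 1 - ϖ ^ (r + s') * w * (1 + ϖ ^ r * u) with hN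
  have hNunit : IsUnit N := by
    have h := Ideal.mem_jacobson_bot.1 hϖ (-(ϖ ^ (r + s' - 1) * w * (1 + ϖ ^ r * u)))
    convert h using 1
    have : ϖ ^ (r + s') = ϖ * ϖ ^ (r + s' - 1) := by
      rw [← pow_succ']; congr 1; omega
    rw [hN, this]; ring
  obtain ⟨N', hN'⟩ := hNunit.exists_right_inv
  obtain ⟨β, hβ⟩ : ∃ β, b * β = 1 :=
    ⟨c b * i N', by rw [← mul_assoc, hb, ← map_mul, hN', map_one]⟩
  have hcβ : c b * c β = 1 := by rw [← map_mul, hβ, map_one]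
  have hβN : β * c β = i N' := by
    have h1 : i N * i N' = 1 := by rw [← map_mul, hN', map_one]
    linear_combination (-(β * c β)) * h1 - β * c β * i N' * hb + i N' * c b * c β * hβ
      + i N' * hcβ
  set y := y₀ * (ϖ ^ (2 * r + s') * w * t * N') with hy
  have hyI : y ∈ I := I.mul_mem_right _ hy₀
  obtain ⟨z, ⟨z', hz'⟩, hz⟩ := exists_sq_eq_one_add_four_mul hyI
  obtain ⟨v, hv⟩ : ∃ v, (1 + 2 * z) * v = 1 := by
    have h4 := isUnit_one_add_of_mem_of_henselianRing (I.mul_mem_left 4 hyI)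
    rw [← hz, isUnit_pow_iff two_ne_zero] at h4
    exact h4.exists_right_inv
  have hiv : (1 + 2 * i z) * i v = 1 := by
    simpa only [map_mul, map_add, map_one, map_ofNat] using congrArg i hv
  set z'' := y₀ * w * t * N' * z' with hz''_def
  have hz'' : i z = i ϖ ^ (2 * r + s') * i z'' := by
    rw [← map_pow, ← map_mul, hz', hy, hz''_def]; congr 1; ring
  have hnorm : 1 - ϖ ^ (r + s') * w * (1 + ϖ ^ r * u') = N * (1 + 2 * z) ^ 2 := by
    rw [hz, hy]
    have : ϖ ^ (2 * r + s') = ϖ ^ (r + s') * ϖ ^ r := by rw [← pow_add]; congr 1; omega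
    rw [this, hN]
    rw [hN] at hN'
    linear_combination ϖ ^ (r + s') * w * ϖ ^ r * ht + ϖ ^ (r + s') * w * ϖ ^ r * t * hk
      - 4 * y₀ * ϖ ^ (r + s') * ϖ ^ r * w * t * hN'
  refine ⟨1 + 2 * i z, b' * β * i v, 2 * i z'',
    ε * i ϖ ^ r' * (d - 2 * b * i ϖ ^ s' * i z'') * β * i v, ?_, ?_, ?_, ?_⟩
  · rw [hz'']; ring
  · have h2 : i ϖ ^ (2 * r) = i ϖ ^ r * (δ * ε) * i ϖ ^ r' := by
      rw [← hδ, ← pow_add, ← pow_add]; congr 1; omega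
    have h3 : i z = i ϖ ^ (2 * r) * i ϖ ^ s' * i z'' := by rw [hz'', pow_add]
    have h4 : b' * β * i v - 1 =
        i ϖ ^ (2 * r) * (d - 2 * b * i ϖ ^ s' * i z'') * β * i v := by
      linear_combination β * i v * hd + (1 + 2 * i z) * i v * hβ + hiv - 2 * b * β * i v * h3
    linear_combination h4 + (d - 2 * b * i ϖ ^ s' * i z'') * β * i v * h2
  · rw [map_mul, map_mul, hci]
    have h5 : N * (1 + 2 * z) ^ 2 * N' * v ^ 2 = 1 := by
      linear_combination (1 + 2 * z) ^ 2 * v ^ 2 * hN' + ((1 + 2 * z) * v + 1) * hv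
    calc b' * β * i v * (c b' * c β * i v) = (b' * c b') * (β * c β) * i v ^ 2 := by ring
      _ = i (N * (1 + 2 * z) ^ 2 * N' * v ^ 2) := by
        rw [hb', hβN, hnorm]; simp only [map_mul, map_pow]
      _ = 1 := by rw [h5, map_one]
  · linear_combination (-b') * hβ - b * β * b' * hiv

end NormTorsor

/-- A set mapped to a finite type has a finite set of representatives for the fibres. -/
lemma exists_finset_representatives {α κ : Type*} [Finite κ] (T : Set α) (f : α → κ) :
    ∃ Reps : Finset α, Reps.card ≤ Nat.card κ ∧ ↑Reps ⊆ T ∧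
      ∀ b ∈ T, ∃ b₀ ∈ Reps, f b₀ = f b := by
  classical
  obtain ⟨U, hUT, hU⟩ := Set.exists_subset_bijOn T f
  have hfin : U.Finite := Set.Finite.of_finite_image (Set.toFinite _) hU.injOn
  refine ⟨hfin.toFinset, ?_, by simpa using hUT, fun b hb => ?_⟩
  · rw [← Set.ncard_eq_toFinset_card U hfin, ← hU.injOn.ncard_image]
    exact Set.ncard_le_card _
  · obtain ⟨b₀, hb₀, h⟩ := hU.surjOn (Set.mem_image_of_mem f hb)
    exact ⟨b₀, by simpa using hb₀, h⟩

section RingOfIntegers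

variable {p : ℕ} [Fact p.Prime] {K L : Type*} [Field K] [Field L] [Algebra ℚ_[p] K]
  [Algebra ℚ_[p] L]

lemma map_mem_ringOfIntegers (f : K →+* L)
    (hf : f.comp (algebraMap ℚ_[p] K) = algebraMap ℚ_[p] L) {x : K}
    (hx : x ∈ ringOfIntegers p K) : f x ∈ ringOfIntegers p L := by
  obtain ⟨P, hP, hPx⟩ := hx
  refine ⟨P, hP, ?_⟩
  have h := Polynomial.hom_eval₂ P
    ((algebraMap ℚ_[p] K).comp (PadicInt.Coe.ringHom)) f x
  rw [← RingHom.comp_assoc, hf] at h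
  refine h.symm.trans ?_
  rw [← map_zero f]
  exact congrArg f hPx

variable (p K) in
/-- The ring of integers is an integral faithful `ℤ_[p]`-algebra; it is finite free if the field is
finite over `ℚ_[p]`. -/
lemma exists_algebra_ringOfIntegers : ∃ _ : Algebra ℤ_[p] (ringOfIntegers p K),
    Algebra.IsIntegral ℤ_[p] (ringOfIntegers p K) ∧ FaithfulSMul ℤ_[p] (ringOfIntegers p K) ∧
    (FiniteDimensional ℚ_[p] K →
      Module.Finite ℤ_[p] (ringOfIntegers p K) ∧ Module.Free ℤ_[p] (ringOfIntegers p K)) := by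
  let _ : Algebra ℤ_[p] K :=
    ((algebraMap ℚ_[p] K).comp (PadicInt.Coe.ringHom)).toAlgebra
  have : IsScalarTower ℤ_[p] ℚ_[p] K := IsScalarTower.of_algebraMap_eq fun _ => rfl
  have : FaithfulSMul ℤ_[p] K := FaithfulSMul.trans ℤ_[p] ℚ_[p] K
  refine ⟨(integralClosure ℤ_[p] K).algebra,
    (inferInstance : Algebra.IsIntegral ℤ_[p] (integralClosure ℤ_[p] K)),
    (inferInstance : FaithfulSMul ℤ_[p] (integralClosure ℤ_[p] K)), fun hfin => ?_⟩
  exact ⟨IsIntegralClosure.finite ℤ_[p] ℚ_[p] K (integralClosure ℤ_[p] K),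
    IsIntegralClosure.module_free ℤ_[p] ℚ_[p] K (integralClosure ℤ_[p] K)⟩

lemma exists_dvd_natCast_pow_ringOfIntegers {x : ringOfIntegers p K} (hx : x ≠ 0) :
    ∃ n : ℕ, x ∣ (p : ringOfIntegers p K) ^ n := by
  obtain ⟨_, hint, _, -⟩ := exists_algebra_ringOfIntegers p K
  exact exists_dvd_natCast_pow hx (hint.isIntegral x)

instance ringOfIntegers_charZero : CharZero (ringOfIntegers p K) := by
  obtain ⟨_, -, _, -⟩ := exists_algebra_ringOfIntegers p K
  exact charZero_of_injective_algebraMap (FaithfulSMul.algebraMap_injective ℤ_[p] _)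

instance ringOfIntegers_henselianRing [FiniteDimensional ℚ_[p] K] :
    HenselianRing (ringOfIntegers p K) (Ideal.span {(p : ringOfIntegers p K)}) := by
  obtain ⟨_, -, -, h⟩ := exists_algebra_ringOfIntegers p K
  obtain ⟨_, _⟩ := h inferInstance
  have := isAdicComplete_span_natCast (p := p) (A := ringOfIntegers p K)
  infer_instance

instance ringOfIntegers_hasFiniteQuotients [FiniteDimensional ℚ_[p] K] :
    Ring.HasFiniteQuotients (ringOfIntegers p K) := by
  obtain ⟨_, -, -, h⟩ := exists_algebra_ringOfIntegers p K
  obtain ⟨_, _⟩ := h inferInstance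
  have := padicInt_hasFiniteQuotients (p := p)
  exact Ring.HasFiniteQuotients.of_module_finite ℤ_[p] _

lemma natCast_prime_dvd_pow_of_not_isUnit [FiniteDimensional ℚ_[p] K] {x : ringOfIntegers p K}
    (hx : ¬IsUnit x) : ∃ n : ℕ, (p : ringOfIntegers p K) ∣ x ^ n := by
  have hp : (p : ringOfIntegers p K) ≠ 0 := Nat.cast_ne_zero.2 (Fact.out : p.Prime).ne_zero
  have : Finite (ringOfIntegers p K ⧸ Ideal.span {(p : ringOfIntegers p K)}) :=
    Ring.HasFiniteQuotients.finiteQuotient (by simpa using hp)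
  obtain ⟨n, hn⟩ := exists_pow_mem_of_not_isUnit
    (I := Ideal.span {(p : ringOfIntegers p K)}) hx
  exact ⟨n, Ideal.mem_span_singleton.1 hn⟩

lemma mem_jacobson_bot_of_not_isUnit [FiniteDimensional ℚ_[p] K] {x : ringOfIntegers p K}
    (hx : ¬IsUnit x) : x ∈ Ideal.jacobson (⊥ : Ideal (ringOfIntegers p K)) := by
  obtain ⟨n, hn⟩ := natCast_prime_dvd_pow_of_not_isUnit hx
  exact Ideal.isRadical_jacobson _
    ⟨n, HenselianRing.jac (I := Ideal.span {(p : ringOfIntegers p K)})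
      (Ideal.mem_span_singleton.2 hn)⟩

end RingOfIntegers

/-- **Uniform boundedness claim of Lemma 4.3(2).**
Let `F` be a finite extension of `ℚ_p` with ring of integers `O_F` and uniformizer `ϖ`, let
`E/F` be a quadratic extension with ring of integers `O_E = O_F + θ·O_F`, and let `c` be the
nontrivial `F`-automorphism of `E`.  For each sufficiently large `r` there exists a constant
`C`, independent of `a`, such that for every `a ∈ F^×` with `v(a) = s ≥ r`, the number of
orbits of `G_a = (1 + ϖ^{r+s}O_E)·N₁(r)` acting by multiplication on
`B_a = {b ∈ O_E : q(b) ∈ 1 − a(1 + ϖ^r O_F)}` is finite and at most `C` (expressed here by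
the existence of at most `C` orbit representatives covering `B_a`). -/
theorem uniform_boundedness_of_orbits
    (p : ℕ) [Fact p.Prime]
    (F : Type*) [Field F] [Algebra ℚ_[p] F] [FiniteDimensional ℚ_[p] F]
    (E : Type*) [Field E] [Algebra ℚ_[p] E] [Algebra F E] [IsScalarTower ℚ_[p] F E]
    (hquad : Module.finrank F E = 2)
    (c : E ≃ₐ[F] E)
    (ϖ : ringOfIntegers p F) (hϖ : Irreducible ϖ)
    (θ : E) (hθmem : θ ∈ ringOfIntegers p E)
    (hgen : ∀ x : E, x ∈ ringOfIntegers p E ↔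
      ∃ a b : ringOfIntegers p F, x = algebraMap F E (a : F) + θ * algebraMap F E (b : F))
    (hθc : c θ ≠ θ) :
    ∃ r₀ : ℕ, 1 ≤ r₀ ∧ ∀ r : ℕ, r₀ ≤ r → ∃ C : ℕ, ∀ s : ℕ, r ≤ s → ∀ a : F,
      (∃ w : (ringOfIntegers p F)ˣ, a = (ϖ : F) ^ s * ((w : ringOfIntegers p F) : F)) →
      ∃ Reps : Finset E, Reps.card ≤ C ∧
        ↑Reps ⊆ BSet p F E (⇑c) ϖ r a ∧
        ∀ b ∈ BSet p F E (⇑c) ϖ r a, ∃ b₀ ∈ Reps, ∃ g ∈ GSet p F E (⇑c) ϖ θ r s,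
          b = b₀ * g := by
  have hϖ0 : ϖ ≠ 0 := hϖ.ne_zero
  have hFE : (algebraMap F E).comp (algebraMap ℚ_[p] F) = algebraMap ℚ_[p] E :=
    (IsScalarTower.algebraMap_eq ℚ_[p] F E).symm
  have hcE : (c : E →+* E).comp (algebraMap ℚ_[p] E) = algebraMap ℚ_[p] E := by
    ext x
    simp [IsScalarTower.algebraMap_apply ℚ_[p] F E]
  let i : ringOfIntegers p F →+* ringOfIntegers p E :=
    (algebraMap F E).restrict _ _ fun _ => map_mem_ringOfIntegers _ hFE
  let c' : ringOfIntegers p E →+* ringOfIntegers p E :=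
    (c : E →+* E).restrict _ _ fun _ => map_mem_ringOfIntegers _ hcE
  have hci : ∀ x, c' (i x) = i x := fun x => Subtype.ext (c.commutes (x : F))
  let θ' : ringOfIntegers p E := ⟨θ, hθmem⟩
  obtain ⟨j, hj⟩ := natCast_prime_dvd_pow_of_not_isUnit hϖ.not_isUnit
  -- a power of `ϖ` divisible by `4p`
  obtain ⟨k, y₀, hy₀, hk⟩ : ∃ k : ℕ, ∃ y₀ ∈ Ideal.span {(p : ringOfIntegers p F)},
      ϖ ^ k = 4 * y₀ := by
    have h4 : (4 : ringOfIntegers p F) ≠ 0 := by norm_num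
    obtain ⟨n, hn⟩ := exists_dvd_natCast_pow_ringOfIntegers h4
    obtain ⟨x, hx⟩ := (mul_dvd_mul_right hn (p : ringOfIntegers p F)).trans
      ((pow_succ _ n).symm.dvd.trans (pow_dvd_pow_of_dvd hj (n + 1)))
    refine ⟨j * (n + 1), p * x, Ideal.mul_mem_right _ _ (Ideal.mem_span_singleton_self _), ?_⟩
    rw [pow_mul, hx, mul_assoc]
  -- a power of `ϖ` divisible by the different `θ - c θ`
  obtain ⟨m, ε, hε⟩ : ∃ m : ℕ, θ' - c' θ' ∣ i ϖ ^ m := by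
    have hδ : θ' - c' θ' ≠ 0 := fun h =>
      hθc (sub_eq_zero.1 (congrArg Subtype.val h)).symm
    obtain ⟨n, hn⟩ := exists_dvd_natCast_pow_ringOfIntegers hδ
    refine ⟨j * n, hn.trans ?_⟩
    have := pow_dvd_pow_of_dvd (map_dvd i hj) n
    rwa [map_natCast, map_pow, ← pow_mul] at this
  refine ⟨m + 1, by omega, fun r hr => ?_⟩
  have hfin : ∀ n : ℕ, Finite (ringOfIntegers p F ⧸ Ideal.span {ϖ ^ n}) := fun n =>
    Ring.HasFiniteQuotients.finiteQuotient (by simp [hϖ0])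
  have := hfin (2 * r)
  have := hfin k
  refine ⟨Nat.card ((ringOfIntegers p F ⧸ Ideal.span {ϖ ^ (2 * r)}) ×
    (ringOfIntegers p F ⧸ Ideal.span {ϖ ^ (2 * r)}) ×
    (ringOfIntegers p F ⧸ Ideal.span {ϖ ^ k})), fun s hs a ⟨w, hw⟩ => ?_⟩
  have hdata : ∀ b : E, ∃ x y u : ringOfIntegers p F, b ∈ BSet p F E c ϖ r a →
      b = algebraMap F E x + θ * algebraMap F E y ∧
        b * c b = algebraMap F E (1 - a * (1 + (ϖ : F) ^ r * u)) := by
    intro b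
    by_cases hb : b ∈ BSet p F E c ϖ r a
    · obtain ⟨x, y, hxy⟩ := (hgen b).1 hb.1
      obtain ⟨u, hu, hbu⟩ := hb.2
      exact ⟨x, y, ⟨u, hu⟩, fun _ => ⟨hxy, hbu⟩⟩
    · exact ⟨0, 0, 0, fun h => absurd h hb⟩
  choose x y u hdata using hdata
  obtain ⟨Reps, hcard, hsub, hReps⟩ := exists_finset_representatives (BSet p F E c ϖ r a)
    fun b => (Ideal.Quotient.mk (Ideal.span {ϖ ^ (2 * r)}) (x b),
      Ideal.Quotient.mk (Ideal.span {ϖ ^ (2 * r)}) (y b),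
      Ideal.Quotient.mk (Ideal.span {ϖ ^ k}) (u b))
  refine ⟨Reps, hcard, hsub, fun b hb => ?_⟩
  obtain ⟨b₀, hb₀, heq⟩ := hReps b hb
  refine ⟨b₀, hb₀, ?_⟩
  have hb₀B := hsub hb₀
  simp only [Prod.mk.injEq, Ideal.Quotient.eq, Ideal.mem_span_singleton] at heq
  obtain ⟨hx, hy, hu⟩ := heq
  obtain ⟨hbxy, hbu⟩ := hdata b hb
  obtain ⟨hb₀xy, hb₀u⟩ := hdata b₀ hb₀B
  have hdvd : i ϖ ^ (2 * r) ∣ (⟨b, hb.1⟩ - ⟨b₀, hb₀B.1⟩ : ringOfIntegers p E) := by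
    have h : (⟨b, hb.1⟩ - ⟨b₀, hb₀B.1⟩ : ringOfIntegers p E) =
        -(i (x b₀ - x b) + θ' * i (y b₀ - y b)) := by
      refine Subtype.ext ?_
      change b - b₀ = -(algebraMap F E (x b₀ - x b : F) + θ * algebraMap F E (y b₀ - y b : F))
      rw [map_sub, map_sub]
      linear_combination hbxy - hb₀xy
    rw [h, dvd_neg, ← map_pow]
    exact dvd_add (map_dvd i hx) ((map_dvd i hy).mul_left _)
  obtain ⟨g₁, g₂, t₁, t₂, hg₁, hg₂, hg₂n, hg⟩ := exists_eq_mul_mul_of_norm_congr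
    (I := Ideal.span {(p : ringOfIntegers p F)}) i c' hci
    (mem_jacobson_bot_of_not_isUnit hϖ.not_isUnit) hy₀ hk hε (by omega) (by omega) hs
    (w := w) (u := u b₀) (u' := u b) (b := ⟨b₀, hb₀B.1⟩) (b' := ⟨b, hb.1⟩)
    (Subtype.ext (by rw [hw] at hb₀u; exact hb₀u)) (Subtype.ext (by rw [hw] at hbu; exact hbu))
    hu hdvd
  refine ⟨g₁ * g₂, ⟨g₁, ⟨t₁, t₁.2, ?_⟩, g₂, ⟨⟨t₂, t₂.2, ?_⟩, congrArg Subtype.val hg₂n⟩, rfl⟩,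
    congrArg Subtype.val hg⟩
  · rw [hg₁, map_pow]; rfl
  · rw [hg₂, map_pow]; rfl
end
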